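/- Let (X_i)_{i=1}^𝔪 be a sequence of infinite-dimensional separable purely atomic Banach lattices satisfying (⋆) for the same constant μ, let 𝐞 be a 1-unconditional basis with 𝔪 terms, and let X := (⊕_i X_i)_𝐞 (such X is order complete, so ℒʳ(X) is a Banach lattice algebra). Let (x_i) be a shrinking basis for X satisfying (⋆) with constant μ in each summand, with biorthogonal functionals (x_i*) and e_n := ∑_{i=1}^n x_i*⊗x_i, and suppose in addition that (x_i) is symmetric. Let e := id_X and let 𝔛 be a Banach lattice ℒʳ(X)-module such that sup_n e_n·x′ = e·x′ and sup_n x′·e_n = x′·e for all x′ ∈ 𝔛′₊. Then every bounded derivation D : ℒʳ(X) → 𝔛′ is regular. -/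

import Mathlib

/- STATEMENT 6 (Corollary cor2): if in addition the basis (x i) is symmetric, then
   every bounded derivation from ℒʳ(X) into the dual of a Banach lattice
   ℒʳ(X)-module 𝔛 with sup_n e_n·x′ = e·x′ and sup_n x′·e_n = x′·e on 𝔛′₊ is regular. -/

open Filter Topology

section Prelude

variable {X 𝔛 : Type*} [NormedAddCommGroup X] [Lattice X] [HasSolidNorm X] [IsOrderedAddMonoid X] [NormedSpace ℝ X]
variable [NormedAddCommGroup 𝔛] [Lattice 𝔛] [HasSolidNorm 𝔛] [IsOrderedAddMonoid 𝔛] [NormedSpace ℝ 𝔛]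

/-- A bounded operator is positive if it maps the positive cone into itself. -/
def IsPosOp (T : X →L[ℝ] X) : Prop := ∀ x : X, 0 ≤ x → 0 ≤ T x

/-- The operator order on regular operators. -/
def opLe (S T : X →L[ℝ] X) : Prop := IsPosOp (T - S)

/-- ℒʳ(X): the regular operators, i.e. linear combinations of positive operators. -/
def LrSet (X : Type*) [NormedAddCommGroup X] [Lattice X] [HasSolidNorm X] [IsOrderedAddMonoid X] [NormedSpace ℝ X] :
    Set (X →L[ℝ] X) :=
  {T | ∃ (n : ℕ) (c : Fin n → ℝ) (S : Fin n → X →L[ℝ] X),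
    (∀ i, IsPosOp (S i)) ∧ T = ∑ i, c i • S i}

/-- The regular norm ‖T‖ᵣ = inf{‖S‖ : |Tx| ≤ S|x| for all x}. -/
noncomputable def rnorm (T : X →L[ℝ] X) : ℝ :=
  sInf {c : ℝ | ∃ S : X →L[ℝ] X, ‖S‖ = c ∧ ∀ x : X, |T x| ≤ S |x|}

/-- ℱ(X): continuous finite-rank operators. -/
def FinRankOp (T : X →L[ℝ] X) : Prop :=
  ∃ (n : ℕ) (f : Fin n → X →L[ℝ] ℝ) (v : Fin n → X), T = ∑ i, (f i).smulRight (v i)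

/-- 𝒜ʳ(X): the ‖·‖ᵣ-closure of ℱ(X) in ℒʳ(X). -/
def ArSet (X : Type*) [NormedAddCommGroup X] [Lattice X] [HasSolidNorm X] [IsOrderedAddMonoid X] [NormedSpace ℝ X] :
    Set (X →L[ℝ] X) :=
  {T | T ∈ LrSet X ∧ ∀ ε : ℝ, 0 < ε → ∃ F : X →L[ℝ] X, FinRankOp F ∧ rnorm (T - F) < ε}

/-- x is a normalized atom of the Banach lattice X. -/
def IsNormAtom (a : X) : Prop :=
  0 < a ∧ ‖a‖ = 1 ∧ ∀ y : X, 0 ≤ y → y ≤ a → ∃ c : ℝ, y = c • a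

/-- The dual (pointwise-on-the-cone) order on 𝔛′ = 𝔛 →L[ℝ] ℝ. -/
def dualLe (f g : 𝔛 →L[ℝ] ℝ) : Prop := ∀ y : 𝔛, 0 ≤ y → f y ≤ g y

/-- Least upper bound with respect to the dual order. -/
def dualIsLUB (S : Set (𝔛 →L[ℝ] ℝ)) (f : 𝔛 →L[ℝ] ℝ) : Prop :=
  (∀ g ∈ S, dualLe g f) ∧ ∀ h : 𝔛 →L[ℝ] ℝ, (∀ g ∈ S, dualLe g h) → dualLe f h

/-- A subset of the dual is weak*-closed. -/
def wstarClosed (S : Set (𝔛 →L[ℝ] ℝ)) : Prop :=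
  IsClosed (StrongDual.toWeakDual '' S)

/-- (y i)_{i<n} and (z i)_{i<n} are L-equivalent. -/
def seqEquivUpTo (L : ℝ) (n : ℕ) (y z : ℕ → X) : Prop :=
  ∀ α : ℕ → ℝ,
    ‖∑ i ∈ Finset.range n, α i • y i‖ ≤ L * ‖∑ i ∈ Finset.range n, α i • z i‖ ∧
    ‖∑ i ∈ Finset.range n, α i • z i‖ ≤ L * ‖∑ i ∈ Finset.range n, α i • y i‖

/-- The sequence (x i) satisfies the selection property (⋆) with constant μ. -/
def StarSeq (μ : ℝ) (x : ℕ → X) : Prop :=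
  ∃ μs : ℕ → ℝ, (∀ n, 1 ≤ μs n ∧ μs n ≤ μ) ∧
    ∀ (n : ℕ) (l : ℕ → ℕ), 0 < n → (∀ i j, i < j → j < n → l i < l j) →
      seqEquivUpTo (μs n) n x (fun i => x (l i)) →
      ∀ k : ℕ, ∃ m : ℕ, l (n - 1) + k ≤ m ∧
        seqEquivUpTo (μs (n + 1)) (n + 1) x (fun i => x (Function.update l n m i))

/-- (x i) is (an enumeration of the normalized atoms of X forming) a basis for
X = (⊕_n X_n)_𝐞 satisfying (⋆) with constant μ in each summand: there is a partition
of ℕ into slices (ψ n ·), n ∈ I, order preserving on each slice, such that on each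
slice the (⋆)-property holds with constant μ, the slices are pairwise disjoint
sublattices, and the decomposition into slices is 1-unconditional. -/
def StarSummandBasis (μ : ℝ) (x : ℕ → X) : Prop :=
  ∃ (I : Set ℕ) (ψ : ℕ → ℕ → ℕ),
    (∀ n ∈ I, StrictMono (ψ n)) ∧
    (∀ i : ℕ, ∃! p : ℕ × ℕ, p.1 ∈ I ∧ ψ p.1 p.2 = i) ∧
    (∀ n ∈ I, StarSeq μ (fun j => x (ψ n j))) ∧
    (∀ i, IsNormAtom (x i)) ∧
    (∀ a : X, IsNormAtom a → ∃ i, x i = a) ∧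
    (∀ n ∈ I, ∀ m ∈ I, n ≠ m → ∀ j j' : ℕ, x (ψ n j) ⊓ x (ψ m j') = 0) ∧
    (∀ (s : Finset ℕ) (α ε : ℕ → ℝ),
      (∀ n ∈ I, ∀ j j' : ℕ, ε (ψ n j) = ε (ψ n j')) → (∀ i, |ε i| ≤ 1) →
      ‖∑ i ∈ s, (ε i * α i) • x i‖ ≤ ‖∑ i ∈ s, α i • x i‖)

/-- A sequence in the dual is equivalent to the unit vector basis of c₀. -/
def EquivC0Basis (ξ : ℕ → (𝔛 →L[ℝ] ℝ)) : Prop :=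
  ∃ L : ℝ, 0 < L ∧ ∀ (m : ℕ) (α : ℕ → ℝ),
    (∀ j < m, |α j| ≤ L * ‖∑ i ∈ Finset.range m, α i • ξ i‖) ∧
    (∀ B : ℝ, 0 ≤ B → (∀ i < m, |α i| ≤ B) →
      ‖∑ i ∈ Finset.range m, α i • ξ i‖ ≤ L * B)

/-- A map D defined (at least) on A ⊆ ℒʳ(X), with values in 𝔛′, is regular if on A it
is a finite linear combination of positive linear maps. -/
def RegularDerivOn (A : Set (X →L[ℝ] X)) (D : (X →L[ℝ] X) → (𝔛 →L[ℝ] ℝ)) : Prop :=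
  ∃ (n : ℕ) (c : Fin n → ℝ) (P : Fin n → (X →L[ℝ] X) → (𝔛 →L[ℝ] ℝ)),
    (∀ t, (∀ a ∈ A, ∀ b ∈ A, P t (a + b) = P t a + P t b) ∧
          (∀ (r : ℝ), ∀ a ∈ A, P t (r • a) = r • P t a) ∧
          (∀ a ∈ A, IsPosOp a → dualLe 0 (P t a))) ∧
    ∀ a ∈ A, D a = ∑ t, c t • P t a

/-- 𝔛 contains a complemented subspace isomorphic to ℓ₁. -/
def HasComplementedL1 (𝔛 : Type*) [NormedAddCommGroup 𝔛] [Lattice 𝔛] [HasSolidNorm 𝔛] [IsOrderedAddMonoid 𝔛] [NormedSpace ℝ 𝔛] :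
    Prop :=
  ∃ (P : 𝔛 →L[ℝ] 𝔛) (e : ℕ → 𝔛) (L : ℝ), 0 < L ∧ P ∘L P = P ∧
    (∀ y : 𝔛, P y ∈ closure (Submodule.span ℝ (Set.range e) : Set 𝔛)) ∧
    (∀ i, P (e i) = e i) ∧
    (∀ (m : ℕ) (α : ℕ → ℝ),
      L⁻¹ * ∑ i ∈ Finset.range m, |α i| ≤ ‖∑ i ∈ Finset.range m, α i • e i‖ ∧
      ‖∑ i ∈ Finset.range m, α i • e i‖ ≤ L * ∑ i ∈ Finset.range m, |α i|)

end Prelude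


section NormedLattice

variable {E : Type*} [NormedAddCommGroup E] [Lattice E] [IsOrderedAddMonoid E]

lemma nonneg_of_two_pow_smul [NormedSpace ℝ E] {y : E} (m : ℕ)
    (h : 0 ≤ (2 ^ m : ℝ) • y) : 0 ≤ y := by
  induction m with
  | zero => simpa using h
  | succ m ih =>
    refine ih (nsmul_two_semiclosed ?_)
    rw [← Nat.cast_smul_eq_nsmul ℝ, smul_smul]
    convert h using 2
    push_cast
    ring

/-- The supremum of an increasing sequence of functionals is its pointwise limit. -/
lemma tendsto_of_dualIsLUB [NormedSpace ℝ E] [CompleteSpace E] {f : ℕ → E →L[ℝ] ℝ} {g : E →L[ℝ] ℝ}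
    (hmono : ∀ n, dualLe (f n) (f (n + 1))) (hlub : dualIsLUB (Set.range f) g) (y : E) :
    Tendsto (fun n => f n y) atTop (𝓝 (g y)) := by
  have hcone : ∀ y : E, 0 ≤ y → ∃ l, Tendsto (fun n => f n y) atTop (𝓝 l) ∧ ∀ n, f n y ≤ l := by
    intro y hy
    have hm : Monotone fun n => f n y := monotone_nat_of_le_succ fun n => hmono n y hy
    have hbd : BddAbove (Set.range fun n => f n y) :=
      ⟨g y, by rintro _ ⟨n, rfl⟩; exact hlub.1 _ ⟨n, rfl⟩ y hy⟩
    exact ⟨_, tendsto_atTop_ciSup hm hbd, le_ciSup hbd⟩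
  have hall : ∀ y : E, ∃ l, Tendsto (fun n => f n y) atTop (𝓝 l) := by
    intro y
    obtain ⟨l₁, h₁, -⟩ := hcone y⁺ (posPart_nonneg y)
    obtain ⟨l₂, h₂, -⟩ := hcone y⁻ (negPart_nonneg y)
    refine ⟨l₁ - l₂, (h₁.sub h₂).congr fun n => ?_⟩
    rw [← map_sub, posPart_sub_negPart]
  choose l hl using hall
  let F : E →L[ℝ] ℝ := continuousLinearMapOfTendsto f (f := l) (tendsto_pi_nhds.2 hl)
  have hF : ∀ y, F y = l y := fun _ => rfl
  have hgF : dualLe g F := by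
    refine hlub.2 F ?_
    rintro _ ⟨n, rfl⟩ y hy
    obtain ⟨l', h', hle⟩ := hcone y hy
    rw [hF, tendsto_nhds_unique (hl y) h']
    exact hle n
  have hFg : dualLe F g := fun y hy =>
    le_of_tendsto' (hl y) fun n => hlub.1 _ ⟨n, rfl⟩ y hy
  have heq : ∀ y : E, 0 ≤ y → g y = l y := fun y hy => le_antisymm (hgF y hy) (hFg y hy)
  have : g y = l y := by
    rw [← hF, ← posPart_sub_negPart y, map_sub, map_sub, heq _ (posPart_nonneg y),
      heq _ (negPart_nonneg y), hF, hF]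
  rw [this]
  exact hl y

lemma inf_add_le_of_nonneg {z a b : E} (hz : 0 ≤ z) (ha : 0 ≤ a) (hb : 0 ≤ b) :
    z ⊓ (a + b) ≤ z ⊓ a + z ⊓ b := by
  rw [add_inf, inf_add, inf_add]
  refine le_inf (le_inf ?_ ?_) (le_inf ?_ ?_)
  · exact inf_le_left.trans (le_add_of_nonneg_right hz)
  · exact inf_le_left.trans (le_add_of_nonneg_left ha)
  · exact inf_le_left.trans (le_add_of_nonneg_right hb)
  · exact inf_le_right

variable [HasSolidNorm E]

lemma norm_posPart_le (y : E) : ‖y⁺‖ ≤ ‖y‖ := by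
  refine norm_le_norm_of_abs_le_abs ?_
  rw [abs_of_nonneg (posPart_nonneg y)]
  exact sup_le (le_abs_self y) (abs_nonneg y)

lemma norm_posPart_add_le (y z : E) : ‖(y + z)⁺‖ ≤ ‖y⁺‖ + ‖z⁺‖ := by
  refine le_trans (norm_le_norm_of_abs_le_abs ?_) (norm_add_le _ _)
  rw [abs_of_nonneg (posPart_nonneg _),
    abs_of_nonneg (add_nonneg (posPart_nonneg y) (posPart_nonneg z))]
  exact sup_le (add_le_add (le_posPart y) (le_posPart z))
    (add_nonneg (posPart_nonneg y) (posPart_nonneg z))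

variable [NormedSpace ℝ E]

lemma solidNorm_smul_nonneg {c : ℝ} (hc : 0 ≤ c) {y : E} (hy : 0 ≤ y) : 0 ≤ c • y := by
  have hfloor : ∀ m : ℕ, 0 ≤ ((⌊c * 2 ^ m⌋₊ : ℝ) / 2 ^ m) • y := by
    intro m
    apply nonneg_of_two_pow_smul m
    rw [smul_smul, mul_div_cancel₀ _ (by positivity), Nat.cast_smul_eq_nsmul ℝ]
    exact nsmul_nonneg hy _
  have hlim : Tendsto (fun m : ℕ => (⌊c * 2 ^ m⌋₊ : ℝ) / 2 ^ m) atTop (𝓝 c) :=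
    (tendsto_nat_floor_mul_div_atTop hc).comp (tendsto_pow_atTop_atTop_of_one_lt one_lt_two)
  exact ge_of_tendsto' (hlim.smul_const y) hfloor

instance solidNorm_isOrderedModule : IsOrderedModule ℝ E where
  smul_le_smul_of_nonneg_left c hc a b hab := by
    have := solidNorm_smul_nonneg hc (sub_nonneg.2 hab)
    rwa [smul_sub, sub_nonneg] at this
  smul_le_smul_of_nonneg_right a ha b c hbc := by
    have := solidNorm_smul_nonneg (sub_nonneg.2 hbc) ha
    rwa [sub_smul, sub_nonneg] at this

lemma norm_posPart_smul {c : ℝ} (hc : 0 < c) (y : E) : ‖(c • y)⁺‖ = c * ‖y⁺‖ := by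
  have key : ∀ {c : ℝ}, 0 < c → ∀ y : E, ‖(c • y)⁺‖ ≤ c * ‖y⁺‖ := by
    intro c hc y
    have h0 : 0 ≤ c • y⁺ := smul_nonneg hc.le (posPart_nonneg y)
    calc ‖(c • y)⁺‖ ≤ ‖c • y⁺‖ := by
          refine norm_le_norm_of_abs_le_abs ?_
          rw [abs_of_nonneg (posPart_nonneg _), abs_of_nonneg h0]
          exact sup_le (smul_le_smul_of_nonneg_left (le_posPart y) hc.le) h0
      _ = c * ‖y⁺‖ := by rw [norm_smul, Real.norm_of_nonneg hc.le]
  refine le_antisymm (key hc y) ?_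
  have := key (inv_pos.2 hc) (c • y)
  rw [smul_smul, inv_mul_cancel₀ hc.ne', one_smul] at this
  calc c * ‖y⁺‖ ≤ c * (c⁻¹ * ‖(c • y)⁺‖) := by gcongr
    _ = ‖(c • y)⁺‖ := by rw [← mul_assoc, mul_inv_cancel₀ hc.ne', one_mul]

/-- Every bounded functional on a normed lattice is a difference of positive ones. -/
lemma exists_dual_pos_sub (η : E →L[ℝ] ℝ) :
    ∃ f g : E →L[ℝ] ℝ, dualLe 0 f ∧ dualLe 0 g ∧ η = f - g := by
  let N : E × E → ℝ := fun p => ‖η‖ * ‖p.1⁺‖ + ‖η‖ * ‖p.2⁺‖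
  let S : Submodule ℝ (E × E) := LinearMap.ker (LinearMap.fst ℝ E E + LinearMap.snd ℝ E E)
  have hS : ∀ p : E × E, p ∈ S ↔ p.2 = -p.1 := by
    intro p
    simp only [S, LinearMap.mem_ker, LinearMap.add_apply, LinearMap.fst_apply,
      LinearMap.snd_apply, eq_neg_iff_add_eq_zero, add_comm]
  obtain ⟨G, hG, hGN⟩ := exists_extension_of_le_sublinear
    (⟨S, ((η : E →ₗ[ℝ] ℝ) ∘ₗ LinearMap.fst ℝ E E).domRestrict S⟩ : (E × E) →ₗ.[ℝ] ℝ) N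
    (by
      intro c hc p
      simp only [N, Prod.smul_fst, Prod.smul_snd, norm_posPart_smul hc]
      ring)
    (by
      intro p q
      have h1 := mul_le_mul_of_nonneg_left (norm_posPart_add_le p.1 q.1) (norm_nonneg η)
      have h2 := mul_le_mul_of_nonneg_left (norm_posPart_add_le p.2 q.2) (norm_nonneg η)
      simp only [N, Prod.fst_add, Prod.snd_add]
      linarith)
    (by
      rintro ⟨p, hp⟩
      have hp2 := (hS p).1 hp
      change η p.1 ≤ ‖η‖ * ‖p.1⁺‖ + ‖η‖ * ‖p.2⁺‖
      rw [hp2, posPart_neg, ← mul_add]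
      calc η p.1 ≤ ‖η‖ * ‖p.1‖ := (le_abs_self _).trans (η.le_opNorm _)
        _ ≤ ‖η‖ * (‖p.1⁺‖ + ‖p.1⁻‖) := by
          gcongr
          nth_rewrite 1 [← posPart_sub_negPart p.1]
          exact norm_sub_le _ _)
  have hb : ∀ p : E × E, |G p| ≤ ‖η‖ * ‖p.1‖ + ‖η‖ * ‖p.2‖ := by
    have hle : ∀ p : E × E, G p ≤ ‖η‖ * ‖p.1‖ + ‖η‖ * ‖p.2‖ := fun p =>
      (hGN p).trans (by simp only [N]; gcongr <;> exact norm_posPart_le _)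
    intro p
    refine abs_le.2 ⟨?_, hle p⟩
    have := hle (-p)
    simp only [map_neg, Prod.fst_neg, Prod.snd_neg, norm_neg] at this
    linarith
  have hpos : ∀ p : E × E, 0 ≤ p.1 → 0 ≤ p.2 → 0 ≤ G p := by
    intro p h1 h2
    have := hGN (-p)
    simp only [N, map_neg, Prod.fst_neg, Prod.snd_neg, posPart_neg, negPart_eq_zero.2 h1,
      negPart_eq_zero.2 h2, norm_zero, mul_zero, add_zero] at this
    linarith
  refine ⟨(G ∘ₗ LinearMap.inl ℝ E E).mkContinuous ‖η‖ fun y => ?_,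
    (G ∘ₗ LinearMap.inr ℝ E E).mkContinuous ‖η‖ fun y => ?_, fun y hy => ?_, fun y hy => ?_, ?_⟩
  · simpa using hb (y, 0)
  · simpa using hb (0, y)
  · simpa using hpos (y, 0) hy le_rfl
  · simpa using hpos (0, y) le_rfl hy
  · ext y
    have h := hG ⟨(y, -y), (hS _).2 rfl⟩
    have h2 : G (y, 0) - G (0, y) = G (y, -y) := by
      rw [← map_sub]
      simp
    simp only [sub_apply, LinearMap.mkContinuous_apply, LinearMap.comp_apply,
      LinearMap.inl_apply, LinearMap.inr_apply, h2]
    exact h.symm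

end NormedLattice

section AtomicBasis

variable {X : Type*} [NormedAddCommGroup X] [Lattice X] [NormedSpace ℝ X]

/-- A Schauder basis of a Banach lattice made of normalized atoms. -/
structure IsAtomicBasis (x : ℕ → X) (xs : ℕ → X →L[ℝ] ℝ) : Prop where
  atom : ∀ i, IsNormAtom (x i)
  biorth : ∀ i j, xs i (x j) = if i = j then (1 : ℝ) else 0
  tendsto_sum : ∀ y : X,
    Tendsto (fun n => ∑ i ∈ Finset.range n, xs i y • x i) atTop (𝓝 y)

namespace IsAtomicBasis

variable {x : ℕ → X} {xs : ℕ → X →L[ℝ] ℝ}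

lemma pos (h : IsAtomicBasis x xs) (i : ℕ) : 0 ≤ x i := (h.atom i).1.le

lemma coord_sum (h : IsAtomicBasis x xs) (s : Finset ℕ) (α : ℕ → ℝ) (j : ℕ) :
    xs j (∑ i ∈ s, α i • x i) = if j ∈ s then α j else 0 := by
  simp [map_sum, h.biorth]

lemma norm_eq_one (h : IsAtomicBasis x xs) (i : ℕ) : ‖x i‖ = 1 := (h.atom i).2.1

lemma inf_eq_zero (h : IsAtomicBasis x xs) {i j : ℕ} (hij : i ≠ j) : x i ⊓ x j = 0 := by
  have h0 : 0 ≤ x i ⊓ x j := le_inf (h.pos i) (h.pos j)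
  obtain ⟨c, hc⟩ := (h.atom i).2.2 _ h0 inf_le_left
  obtain ⟨d, hd⟩ := (h.atom j).2.2 _ h0 inf_le_right
  have : xs i (c • x i) = xs i (d • x j) := by rw [← hc, ← hd]
  simp only [map_smul, h.biorth, if_pos, if_neg hij, smul_eq_mul, mul_one, mul_zero] at this
  rw [hc, this, zero_smul]

variable [HasSolidNorm X] [IsOrderedAddMonoid X]

lemma smul_inf_smul_eq_zero (h : IsAtomicBasis x xs) {i j : ℕ} (hij : i ≠ j)
    {a b : ℝ} (ha : 0 ≤ a) (hb : 0 ≤ b) :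
    a • x i ⊓ b • x j = 0 := by
  have hc : 0 < a + b + 1 := by positivity
  refine le_antisymm ?_ (le_inf (smul_nonneg ha (h.pos i)) (smul_nonneg hb (h.pos j)))
  have key : (a + b + 1)⁻¹ • (a • x i ⊓ b • x j) ≤ x i ⊓ x j := by
    refine le_inf ?_ ?_
    · rw [inv_smul_le_iff_of_pos hc]
      exact inf_le_left.trans (smul_le_smul_of_nonneg_right (by linarith) (h.pos i))
    · rw [inv_smul_le_iff_of_pos hc]
      exact inf_le_right.trans (smul_le_smul_of_nonneg_right (by linarith) (h.pos j))
  rw [h.inf_eq_zero hij, inv_smul_le_iff_of_pos hc, smul_zero] at key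
  exact key

lemma smul_inf_sum_le (h : IsAtomicBasis x xs) {j : ℕ} {s : Finset ℕ} (hj : j ∉ s)
    {a : ℝ} (ha : 0 ≤ a) {β : ℕ → ℝ}
    (hβ : ∀ i, 0 ≤ β i) : a • x j ⊓ ∑ i ∈ s, β i • x i ≤ 0 := by
  induction s using Finset.induction_on with
  | empty => simp
  | insert k s hk ih =>
    rw [Finset.sum_insert hk]
    have hjk : j ≠ k := fun e => hj (e ▸ Finset.mem_insert_self k s)
    have hs : 0 ≤ ∑ i ∈ s, β i • x i :=
      Finset.sum_nonneg fun i _ => smul_nonneg (hβ i) (h.pos i)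
    refine (inf_add_le_of_nonneg (smul_nonneg ha (h.pos j)) (smul_nonneg (hβ k) (h.pos k)) hs).trans
      ?_
    rw [h.smul_inf_smul_eq_zero hjk ha (hβ k), zero_add]
    exact ih fun hjs => hj (Finset.mem_insert_of_mem hjs)

lemma coord_nonneg (h : IsAtomicBasis x xs) (j : ℕ) {y : X} (hy : 0 ≤ y) : 0 ≤ xs j y := by
  by_contra! hneg
  set t : ℝ := -xs j y with ht
  have htpos : 0 < t := by linarith
  have hlim : Tendsto (fun n => t • x j ⊓ (∑ i ∈ Finset.range n, xs i y • x i + t • x j)) atTop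
      (𝓝 (t • x j ⊓ (y + t • x j))) :=
    tendsto_const_nhds.inf_nhds ((h.tendsto_sum y).add_const _)
  have hle : t • x j ⊓ (y + t • x j) ≤ 0 := by
    refine le_of_tendsto hlim ?_
    filter_upwards [eventually_gt_atTop j] with n hn
    have hmem : j ∈ Finset.range n := Finset.mem_range.2 hn
    have hsum : ∑ i ∈ Finset.range n, xs i y • x i + t • x j
        ≤ ∑ i ∈ (Finset.range n).erase j, |xs i y| • x i := by
      rw [← Finset.add_sum_erase _ _ hmem, ht, neg_smul, add_neg_cancel_comm]
      exact Finset.sum_le_sum fun i _ =>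
        smul_le_smul_of_nonneg_right (le_abs_self _) (h.pos i)
    exact (inf_le_inf_left _ hsum).trans
      (h.smul_inf_sum_le (Finset.notMem_erase j _) htpos.le fun i => abs_nonneg _)
  rw [inf_eq_left.2 (le_add_of_nonneg_left hy)] at hle
  have h0 : t • x j = 0 := le_antisymm hle (smul_nonneg htpos.le (h.pos j))
  exact (smul_ne_zero htpos.ne' (h.atom j).1.ne') h0

lemma abs_coord_le (h : IsAtomicBasis x xs) (j : ℕ) (y : X) : |xs j y| ≤ xs j |y| := by
  refine abs_le'.2 ⟨?_, ?_⟩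
  · rw [← sub_nonneg, ← map_sub]
    exact h.coord_nonneg j (sub_nonneg.2 (le_abs_self y))
  · rw [← map_neg, ← sub_nonneg, ← map_sub]
    exact h.coord_nonneg j (sub_nonneg.2 (neg_le_abs y))

lemma sum_coord_le (h : IsAtomicBasis x xs) (s : Finset ℕ) {y : X} (hy : 0 ≤ y) :
    ∑ i ∈ s, xs i y • x i ≤ y := by
  obtain ⟨m, hm⟩ := s.exists_nat_subset_range
  refine ge_of_tendsto (h.tendsto_sum y) ?_
  filter_upwards [eventually_ge_atTop m] with n hn
  exact Finset.sum_le_sum_of_subset_of_nonneg (hm.trans (Finset.range_subset_range.2 hn))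
    fun i _ _ => smul_nonneg (h.coord_nonneg i hy) (h.pos i)

lemma abs_sum_le (h : IsAtomicBasis x xs) {ι : Type*} (s : Finset ι) (f : ι → ℕ) (α : ι → ℝ) :
    |∑ i ∈ s, α i • x (f i)| ≤ ∑ i ∈ s, |α i| • x (f i) := by
  refine abs_le'.2 ⟨?_, ?_⟩
  · exact Finset.sum_le_sum fun i _ => smul_le_smul_of_nonneg_right (le_abs_self _) (h.pos _)
  · rw [← Finset.sum_neg_distrib]
    refine Finset.sum_le_sum fun i _ => ?_
    rw [← neg_smul]
    exact smul_le_smul_of_nonneg_right (neg_le_abs _) (h.pos _)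

lemma norm_sum_coord_le (h : IsAtomicBasis x xs) (s : Finset ℕ) (y : X) :
    ‖∑ i ∈ s, xs i y • x i‖ ≤ ‖y‖ := by
  refine norm_le_norm_of_abs_le_abs ?_
  calc |∑ i ∈ s, xs i y • x i| ≤ ∑ i ∈ s, |xs i y| • x i := h.abs_sum_le s id _
    _ ≤ ∑ i ∈ s, xs i |y| • x i := Finset.sum_le_sum fun i _ =>
        smul_le_smul_of_nonneg_right (h.abs_coord_le i y) (h.pos i)
    _ ≤ |y| := h.sum_coord_le s (abs_nonneg y)

lemma norm_sum_le_of_subset (h : IsAtomicBasis x xs) {s t : Finset ℕ} (hst : s ⊆ t) (α : ℕ → ℝ) :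
    ‖∑ i ∈ s, α i • x i‖ ≤ ‖∑ i ∈ t, α i • x i‖ := by
  convert h.norm_sum_coord_le s (∑ i ∈ t, α i • x i) using 2
  exact Finset.sum_congr rfl fun i hi => by rw [h.coord_sum, if_pos (hst hi)]

lemma abs_le_norm_sum (h : IsAtomicBasis x xs) {t : Finset ℕ} {j : ℕ} (hj : j ∈ t) (α : ℕ → ℝ) :
    |α j| ≤ ‖∑ i ∈ t, α i • x i‖ := by
  have := h.norm_sum_le_of_subset (Finset.singleton_subset_iff.2 hj) α
  rwa [Finset.sum_singleton, norm_smul, h.norm_eq_one, mul_one, Real.norm_eq_abs] at this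

end IsAtomicBasis

end AtomicBasis

section SymmetricBasis

variable {X : Type*} [NormedAddCommGroup X] [Lattice X] [NormedSpace ℝ X] {x : ℕ → X}
  {xs : ℕ → X →L[ℝ] ℝ}

/-- Permutations of `{N, …, n - 1}` act on the basis with a bound independent of `n`. -/
def UniformlySymmetricFrom (x : ℕ → X) (N : ℕ) : Prop :=
  ∃ K : ℝ, ∀ (n : ℕ) (σ : Equiv.Perm ℕ), (∀ i < N, σ i = i) → (∀ i, n ≤ i → σ i = i) →
    ∀ α : ℕ → ℝ, ‖∑ i ∈ Finset.range n, α i • x (σ i)‖ ≤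
      K * ‖∑ i ∈ Finset.range n, α i • x i‖

variable [HasSolidNorm X] [IsOrderedAddMonoid X]

lemma IsAtomicBasis.uniformlySymmetricFrom_of_succ (h : IsAtomicBasis x xs) {N : ℕ}
    (hN : UniformlySymmetricFrom x (N + 1)) : UniformlySymmetricFrom x N := by
  obtain ⟨K, hK⟩ := hN
  refine ⟨|K| + 4, fun n σ hσ hσn α => ?_⟩
  set B := ‖∑ i ∈ Finset.range n, α i • x i‖ with hB
  have hB0 : 0 ≤ B := norm_nonneg _
  rcases le_or_gt n N with hnN | hnN
  · have hid : ∀ i, σ i = i := fun i =>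
      (lt_or_ge i N).elim (hσ i) fun hi => hσn i (hnN.trans hi)
    simp only [hid]
    rw [← hB]
    nlinarith [abs_nonneg K]
  set τ : Equiv.Perm ℕ := σ.trans (Equiv.swap N (σ N)) with hτ
  have hτi : ∀ i, i ≠ N → i ≠ σ.symm N → τ i = σ i := fun i h1 h2 =>
    Equiv.swap_apply_of_ne_of_ne (fun e => h2 ((Equiv.eq_symm_apply σ).2 e))
      fun e => h1 (σ.injective e)
  have hτN : τ N = N := by simp [hτ]
  have hτ1 : ∀ i < N + 1, τ i = i := by
    intro i hi
    rcases (Nat.lt_succ_iff.1 hi).eq_or_lt with rfl | hi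
    · exact hτN
    · rw [hτi i hi.ne, hσ i hi]
      intro e
      have := (Equiv.eq_symm_apply σ).1 e
      rw [hσ i hi] at this
      exact hi.ne this
  have hτ2 : ∀ i, n ≤ i → τ i = i := by
    intro i hi
    rw [hτi i (by lia), hσn i hi]
    intro e
    have := (Equiv.eq_symm_apply σ).1 e
    rw [hσn i hi] at this
    lia
  have h1 := hK n τ hτ1 hτ2 α
  have h2 : ∀ i ∈ Finset.range n, ‖α i • (x (σ i) - x (τ i))‖ ≤
      (if i = N then 2 * B else 0) + if i = σ.symm N then 2 * B else 0 := by
    intro i hi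
    by_cases hc : i = N ∨ i = σ.symm N
    · have hle : ‖α i • (x (σ i) - x (τ i))‖ ≤ 2 * B := by
        rw [norm_smul, Real.norm_eq_abs, mul_comm]
        refine mul_le_mul ((norm_sub_le _ _).trans_eq ?_) (h.abs_le_norm_sum hi α)
          (abs_nonneg _) zero_le_two
        rw [h.norm_eq_one, h.norm_eq_one]
        norm_num
      rcases hc with hc | hc
      · rw [if_pos hc]
        split_ifs <;> linarith
      · rw [if_pos hc]
        split_ifs <;> linarith
    · push Not at hc
      rw [hτi i hc.1 hc.2, sub_self, smul_zero, norm_zero, if_neg hc.1, if_neg hc.2, add_zero]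
  have h3 : ‖∑ i ∈ Finset.range n, α i • (x (σ i) - x (τ i))‖ ≤ 2 * B + 2 * B := by
    refine (norm_sum_le_of_le _ h2).trans ?_
    rw [Finset.sum_add_distrib, Finset.sum_ite_eq', Finset.sum_ite_eq']
    refine add_le_add ?_ ?_ <;> split_ifs <;> linarith
  calc ‖∑ i ∈ Finset.range n, α i • x (σ i)‖
      = ‖∑ i ∈ Finset.range n, α i • x (τ i) +
          ∑ i ∈ Finset.range n, α i • (x (σ i) - x (τ i))‖ := by
        rw [← Finset.sum_add_distrib]
        congr 1
        exact Finset.sum_congr rfl fun i _ => by rw [← smul_add, add_sub_cancel]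
    _ ≤ K * B + (2 * B + 2 * B) := (norm_add_le _ _).trans (add_le_add h1 h3)
    _ ≤ (|K| + 4) * B := by nlinarith [le_abs_self K]

/-- Permutations preserving each of the blocks `[b k, b (k + 1))` glue to a permutation. -/
lemma exists_perm_of_blocks {b : ℕ → ℕ} (hb : StrictMono b) (hb0 : b 0 = 0)
    (σ : ℕ → Equiv.Perm ℕ) (hσ : ∀ k i, i < b k → σ k i = i)
    (hσ' : ∀ k i, b (k + 1) ≤ i → σ k i = i) :
    ∃ π : Equiv.Perm ℕ, ∀ k, ∀ i ∈ Finset.Ico (b k) (b (k + 1)), π i = σ k i := by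
  have hex : ∀ i, ∃ k, b k ≤ i ∧ i < b (k + 1) := by
    intro i
    have hne : ∃ k, i < b (k + 1) := ⟨i, (Nat.lt_succ_self i).trans_le (hb.le_apply)⟩
    classical
    refine ⟨Nat.find hne, ?_, Nat.find_spec hne⟩
    rcases Nat.eq_zero_or_pos (Nat.find hne) with h0 | h0
    · rw [h0, hb0]
      exact Nat.zero_le i
    · have := Nat.find_min hne (Nat.sub_lt h0 one_pos)
      rw [Nat.sub_add_cancel (Nat.one_le_iff_ne_zero.2 h0.ne')] at this
      exact not_lt.1 this
  choose κ hκ using hex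
  have huniq : ∀ i k, b k ≤ i → i < b (k + 1) → κ i = k := by
    intro i k h1 h2
    have h3 := hb.lt_iff_lt.1 ((hκ i).1.trans_lt h2)
    have h4 := hb.lt_iff_lt.1 (h1.trans_lt (hκ i).2)
    lia
  have hfix : ∀ (k i : ℕ) (ρ : Equiv.Perm ℕ), (∀ j < b k, ρ j = j) →
      (∀ j, b (k + 1) ≤ j → ρ j = j) → b k ≤ i → i < b (k + 1) → κ (ρ i) = k := by
    intro k i ρ h1 h2 hi hi'
    refine huniq _ _ ?_ ?_
    · by_contra! hlt
      have := ρ.injective (h1 _ hlt)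
      lia
    · by_contra! hge
      have := ρ.injective (h2 _ hge)
      lia
  have hsymm : ∀ {ρ : Equiv.Perm ℕ} {i : ℕ}, ρ i = i → ρ.symm i = i := fun e =>
    ((Equiv.eq_symm_apply _).2 e).symm
  have hκ1 : ∀ i, κ (σ (κ i) i) = κ i := fun i =>
    hfix _ _ _ (hσ _) (hσ' _) (hκ i).1 (hκ i).2
  have hκ2 : ∀ i, κ ((σ (κ i)).symm i) = κ i := fun i =>
    hfix _ _ _ (fun j hj => hsymm (hσ _ j hj)) (fun j hj => hsymm (hσ' _ j hj))
      (hκ i).1 (hκ i).2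
  refine ⟨⟨fun i => σ (κ i) i, fun i => (σ (κ i)).symm i, fun i => ?_, fun i => ?_⟩, ?_⟩
  · simp only [hκ1, Equiv.symm_apply_apply]
  · simp only [hκ2, Equiv.apply_symm_apply]
  · intro k i hi
    rw [Finset.mem_Ico] at hi
    change σ (κ i) i = σ k i
    rw [huniq i k hi.1 hi.2]

/-- A gliding hump: a symmetric basis is uniformly symmetric far out. -/
lemma IsAtomicBasis.exists_uniformlySymmetricFrom (h : IsAtomicBasis x xs)
    (hsym : ∀ π : Equiv.Perm ℕ, ∃ L : ℝ, 0 < L ∧ ∀ (m : ℕ) (α : ℕ → ℝ),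
      ‖∑ i ∈ Finset.range m, α i • x i‖ ≤ L * ‖∑ i ∈ Finset.range m, α i • x (π i)‖ ∧
      ‖∑ i ∈ Finset.range m, α i • x (π i)‖ ≤ L * ‖∑ i ∈ Finset.range m, α i • x i‖) :
    ∃ N, UniformlySymmetricFrom x N := by
  by_contra! hcon
  have hbad : ∀ N k : ℕ, ∃ (n : ℕ) (σ : Equiv.Perm ℕ) (α : ℕ → ℝ), N < n ∧
      (∀ i < N, σ i = i) ∧ (∀ i, n ≤ i → σ i = i) ∧
      k * ‖∑ i ∈ Finset.Ico N n, α i • x i‖ < ‖∑ i ∈ Finset.Ico N n, α i • x (σ i)‖ := by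
    intro N k
    have := hcon N
    simp only [UniformlySymmetricFrom] at this
    push Not at this
    obtain ⟨n, σ, h1, h2, α, h3⟩ := this (k + 1)
    have hNn : N < n := by
      by_contra! hle
      have hid : ∀ i, σ i = i := fun i =>
        (lt_or_ge i N).elim (h1 i) fun hi => h2 i (hle.trans hi)
      simp only [hid] at h3
      nlinarith [norm_nonneg (∑ i ∈ Finset.range n, α i • x i),
        (Nat.cast_nonneg k : (0 : ℝ) ≤ k)]
    refine ⟨n, σ, α, hNn, h1, h2, ?_⟩
    have hsplit : ∑ i ∈ Finset.range n, α i • x (σ i) =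
        ∑ i ∈ Finset.range N, α i • x i + ∑ i ∈ Finset.Ico N n, α i • x (σ i) := by
      rw [← Finset.sum_range_add_sum_Ico _ hNn.le]
      congr 1
      exact Finset.sum_congr rfl fun i hi => by rw [h1 i (Finset.mem_range.1 hi)]
    have h4 : ‖∑ i ∈ Finset.range N, α i • x i‖ ≤ ‖∑ i ∈ Finset.range n, α i • x i‖ :=
      h.norm_sum_le_of_subset (Finset.range_subset_range.2 hNn.le) α
    have h5 : ‖∑ i ∈ Finset.Ico N n, α i • x i‖ ≤ ‖∑ i ∈ Finset.range n, α i • x i‖ :=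
      h.norm_sum_le_of_subset (fun i hi => Finset.mem_range.2 (Finset.mem_Ico.1 hi).2) α
    rw [hsplit] at h3
    have h6 := h3.trans_le (norm_add_le _ _)
    have h7 := mul_le_mul_of_nonneg_left h5 (Nat.cast_nonneg k : (0 : ℝ) ≤ k)
    linarith
  choose nx σ α hlt hσ hσ' hgt using hbad
  let b : ℕ → ℕ := fun k => Nat.rec 0 (fun k N => nx N k) k
  have hbs : ∀ k, b (k + 1) = nx (b k) k := fun _ => rfl
  have hb : StrictMono b := strictMono_nat_of_lt_succ fun k => hlt (b k) k
  obtain ⟨π, hπ⟩ := exists_perm_of_blocks hb rfl (fun k => σ (b k) k)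
    (fun k => hσ (b k) k) (fun k => hσ' (b k) k)
  obtain ⟨L, -, hL⟩ := hsym π
  obtain ⟨k, hk⟩ := exists_nat_gt L
  set I := Finset.Ico (b k) (b (k + 1)) with hI
  have hIr : I ⊆ Finset.range (b (k + 1)) := fun i hi => Finset.mem_range.2 (Finset.mem_Ico.1 hi).2
  have hsum : ∀ f : ℕ → X, ∑ i ∈ Finset.range (b (k + 1)),
      (if i ∈ I then α (b k) k i else 0) • f i = ∑ i ∈ I, α (b k) k i • f i := by
    intro f
    rw [← Finset.sum_subset hIr]
    · exact Finset.sum_congr rfl fun i hi => by rw [if_pos hi]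
    · intro i _ hi
      rw [if_neg hi, zero_smul]
  have h1 := (hL (b (k + 1)) fun i => if i ∈ I then α (b k) k i else 0).2
  rw [hsum, hsum, Finset.sum_congr rfl fun i hi => by rw [hπ k i hi]] at h1
  have h2 := hgt (b k) k
  rw [← hbs, ← hI] at h2
  have h3 := mul_le_mul_of_nonneg_right hk.le (norm_nonneg (∑ i ∈ I, α (b k) k i • x i))
  linarith

lemma IsAtomicBasis.exists_symmetric_bound (h : IsAtomicBasis x xs)
    (hsym : ∀ π : Equiv.Perm ℕ, ∃ L : ℝ, 0 < L ∧ ∀ (m : ℕ) (α : ℕ → ℝ),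
      ‖∑ i ∈ Finset.range m, α i • x i‖ ≤ L * ‖∑ i ∈ Finset.range m, α i • x (π i)‖ ∧
      ‖∑ i ∈ Finset.range m, α i • x (π i)‖ ≤ L * ‖∑ i ∈ Finset.range m, α i • x i‖) :
    ∃ K : ℝ, 0 ≤ K ∧ ∀ (n : ℕ) (τ : Equiv.Perm (Fin n)) (α : ℕ → ℝ),
      ‖∑ i : Fin n, α i • x (τ i)‖ ≤ K * ‖∑ i ∈ Finset.range n, α i • x i‖ := by
  obtain ⟨N, hN⟩ := h.exists_uniformlySymmetricFrom hsym
  have h0 : UniformlySymmetricFrom x 0 := by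
    induction N with
    | zero => exact hN
    | succ N ih => exact ih (h.uniformlySymmetricFrom_of_succ hN)
  obtain ⟨K, hK⟩ := h0
  refine ⟨|K|, abs_nonneg K, fun n τ α => ?_⟩
  have := hK n (τ.extendDomain Fin.equivSubtype) (by simp)
    (fun i hi => Equiv.Perm.extendDomain_apply_not_subtype _ _ (not_lt.2 hi)) α
  rw [Finset.sum_range] at this
  have himg : ∀ i : Fin n, τ.extendDomain Fin.equivSubtype (i : ℕ) = (τ i : ℕ) :=
    fun i => Equiv.Perm.extendDomain_apply_image τ Fin.equivSubtype i
  simp only [himg] at this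
  exact this.trans (mul_le_mul_of_nonneg_right (le_abs_self K) (norm_nonneg _))

end SymmetricBasis

section MatrixUnits

/-- Averaging over signs: a bound for `β (∑ εᵢ uᵢ) (∑ εᵢ vᵢ)` uniform in the signs `ε` bounds the
diagonal sum `∑ β uᵢ vᵢ`. -/
lemma abs_sum_add_le_of_signs {A ι : Type*} [AddCommGroup A] [Module ℝ A]
    (β : A →ₗ[ℝ] A →ₗ[ℝ] ℝ) {K : ℝ} (u v : ι → A) (s : Finset ι) (w : ℝ)
    (hK : ∀ ε : ι → ℝ, (∀ i, |ε i| = 1) →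
      |β (∑ i ∈ s, ε i • u i) (∑ i ∈ s, ε i • v i) + w| ≤ K) :
    |∑ i ∈ s, β (u i) (v i) + w| ≤ K := by
  classical
  induction s using Finset.induction_on generalizing w with
  | empty => simpa using hK (fun _ => 1) (by simp)
  | insert a s ha ih =>
    rw [Finset.sum_insert ha, add_comm (β (u a) (v a)), add_assoc]
    refine ih _ fun ε hε => ?_
    have hupd : ∀ (c : ℝ) (f : ι → A),
        ∑ i ∈ insert a s, Function.update ε a c i • f i = c • f a + ∑ i ∈ s, ε i • f i := by
      intro c f
      rw [Finset.sum_insert ha, Function.update_self]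
      congr 1
      refine Finset.sum_congr rfl fun i hi => ?_
      rw [Function.update_of_ne (fun e : i = a => ha (e ▸ hi))]
    have hone : ∀ c : ℝ, |c| = 1 → ∀ i, |Function.update ε a c i| = 1 := by
      intro c hc i
      rcases eq_or_ne i a with rfl | hi
      · rwa [Function.update_self]
      · rw [Function.update_of_ne hi, hε]
    have h1 := hK _ (hone 1 (by simp))
    have h2 := hK _ (hone (-1) (by simp))
    simp only [hupd, map_add, map_smul, LinearMap.add_apply, LinearMap.smul_apply, smul_eq_mul]
      at h1 h2
    rw [abs_le] at h1 h2 ⊢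
    constructor <;> linarith [h1.1, h1.2, h2.1, h2.2]

/-- Bounded sequences of functionals have pointwise limits along an ultrafilter. -/
lemma exists_hyperfilter_limit {W : Type*} [NormedAddCommGroup W] [NormedSpace ℝ W] {K : ℝ}
    (ξ : ℕ → W →L[ℝ] ℝ) (hξ : ∀ n y, |ξ n y| ≤ K * ‖y‖) :
    ∃ η : W →L[ℝ] ℝ, ∀ y, Tendsto (fun n => ξ n y) (hyperfilter ℕ) (𝓝 (η y)) := by
  have hlim : ∀ y, ∃ l, Tendsto (fun n => ξ n y) (hyperfilter ℕ) (𝓝 l) := by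
    intro y
    have hmem : ∀ n, ξ n y ∈ Set.Icc (-(K * ‖y‖)) (K * ‖y‖) := fun n => abs_le.1 (hξ n y)
    obtain ⟨l, -, hl⟩ := isCompact_Icc.ultrafilter_le_nhds
      ((hyperfilter ℕ).map fun n => ξ n y)
      (le_principal_iff.2 (Filter.mem_map.2 (Filter.univ_mem' hmem)))
    exact ⟨l, hl⟩
  choose l hl using hlim
  refine ⟨LinearMap.mkContinuous ⟨⟨l, fun y z => ?_⟩, fun c y => ?_⟩ K fun y => ?_, hl⟩
  · refine tendsto_nhds_unique (hl (y + z)) ?_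
    simpa only [map_add] using (hl y).add (hl z)
  · refine tendsto_nhds_unique (hl (c • y)) ?_
    simpa only [map_smul, RingHom.id_apply] using (hl y).const_smul c
  · exact le_of_tendsto' (hl y).norm fun n => hξ n y

variable {A W : Type*} [Ring A] [Algebra ℝ A] [NormedAddCommGroup W] [NormedSpace ℝ W]

/-- The value at the normalized canonical diagonal `n⁻¹ ∑ eᵢⱼ ⊗ eⱼᵢ` of the `n × n` matrices. -/
noncomputable def diagonalFunctional (e : ℕ → ℕ → A) (L : A →ₗ[ℝ] W →L[ℝ] W)
    (D : A →ₗ[ℝ] W →L[ℝ] ℝ) (n : ℕ) : W →L[ℝ] ℝ :=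
  (n : ℝ)⁻¹ • ∑ i ∈ Finset.range n, ∑ j ∈ Finset.range n, D (e i j) ∘L L (e j i)

lemma diagonalFunctional_apply (e : ℕ → ℕ → A) (L : A →ₗ[ℝ] W →L[ℝ] W)
    (D : A →ₗ[ℝ] W →L[ℝ] ℝ) (n : ℕ) (y : W) :
    diagonalFunctional e L D n y =
      (n : ℝ)⁻¹ * ∑ i ∈ Finset.range n, ∑ j ∈ Finset.range n, D (e i j) (L (e j i) y) := by
  simp [diagonalFunctional]

lemma abs_diagonalFunctional_le {e : ℕ → ℕ → A} {L : A →ₗ[ℝ] W →L[ℝ] W}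
    {D : A →ₗ[ℝ] W →L[ℝ] ℝ} {K : ℝ}
    (hK : ∀ (n : ℕ) (τ : Equiv.Perm (Fin n)) (ε : Fin n → ℝ), (∀ i, |ε i| = 1) → ∀ y,
      |D (∑ i, ε i • e i (τ i)) (L (∑ i, ε i • e (τ i) i) y)| ≤ K * ‖y‖) (n : ℕ) (y : W) :
    |diagonalFunctional e L D n y| ≤ K * ‖y‖ := by
  rw [diagonalFunctional_apply]
  rcases n with _ | n
  · simpa using hK 0 1 (fun _ => 1) (by simp) y
  have hn : (0 : ℝ) < (n + 1 : ℕ) := by positivity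
  rw [abs_mul, abs_of_pos (inv_pos.2 hn), inv_mul_le_iff₀ hn]
  let β : A →ₗ[ℝ] A →ₗ[ℝ] ℝ := LinearMap.mk₂ ℝ (fun a b => D a (L b y))
    (by simp) (by simp) (by simp) (by simp)
  have hshift : ∑ i ∈ Finset.range (n + 1), ∑ j ∈ Finset.range (n + 1), D (e i j) (L (e j i) y) =
      ∑ s : Fin (n + 1), ∑ i : Fin (n + 1),
        D (e i (Equiv.addRight s i)) (L (e (Equiv.addRight s i) i) y) := by
    simp only [Finset.sum_range]
    refine Eq.trans (Finset.sum_congr rfl fun i _ => ?_) Finset.sum_comm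
    exact (Equiv.sum_comp (Equiv.addLeft i)
      fun j : Fin (n + 1) => D (e i j) (L (e j i) y)).symm
  rw [hshift]
  refine (Finset.abs_sum_le_sum_abs _ _).trans ?_
  calc ∑ s : Fin (n + 1), |∑ i : Fin (n + 1),
        D (e i (Equiv.addRight s i)) (L (e (Equiv.addRight s i) i) y)|
      ≤ ∑ _s : Fin (n + 1), K * ‖y‖ := by
        refine Finset.sum_le_sum fun s _ => ?_
        have := abs_sum_add_le_of_signs β (K := K * ‖y‖)
          (fun i : Fin (n + 1) => e i (Equiv.addRight s i))
          (fun i : Fin (n + 1) => e (Equiv.addRight s i) i) Finset.univ 0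
          (fun ε hε => by rw [add_zero]; exact hK (n + 1) (Equiv.addRight s) ε hε y)
        rwa [add_zero] at this
    _ = (n + 1 : ℕ) * (K * ‖y‖) := by simp

variable {e : ℕ → ℕ → A} {L R : A →ₗ[ℝ] W →L[ℝ] W} {D : A →ₗ[ℝ] W →L[ℝ] ℝ}

lemma derivation_matrixUnit
    (he : ∀ i j k l, e i j * e k l = if j = k then e i l else 0)
    (hL : ∀ a b y, L (a * b) y = L a (L b y))
    (hLR : ∀ a b y, L a (R b y) = R b (L a y))
    (hD : ∀ a b y, D (a * b) y = D b (R a y) + D a (L b y))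
    {n k l : ℕ} (hk : k < n) (hl : l < n) (y : W) :
    D (e k l) (L (∑ i ∈ Finset.range n, e i i) y) =
      diagonalFunctional e L D n (L (e k l) y) - diagonalFunctional e L D n (R (e k l) y) := by
  have hn : (n : ℝ) ≠ 0 := Nat.cast_ne_zero.2 (by lia)
  rw [diagonalFunctional_apply, diagonalFunctional_apply, ← mul_sub, eq_inv_mul_iff_mul_eq₀ hn]
  have h1 : ∑ i ∈ Finset.range n, ∑ j ∈ Finset.range n, D (e i j) (L (e j i) (L (e k l) y)) =
      ∑ j ∈ Finset.range n, D (e k j) (L (e j l) y) := by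
    rw [Finset.sum_comm]
    refine Finset.sum_congr rfl fun j _ => ?_
    rw [Finset.sum_eq_single_of_mem k (Finset.mem_range.2 hk), ← hL, he, if_pos rfl]
    intro i _ hik
    rw [← hL, he, if_neg hik, map_zero, zero_apply, map_zero]
  have h2 : ∑ i ∈ Finset.range n, ∑ j ∈ Finset.range n, D (e i j) (L (e j i) (R (e k l) y)) =
      ∑ j ∈ Finset.range n, D (e k j) (L (e j l) y) -
        n * D (e k l) (L (∑ i ∈ Finset.range n, e i i) y) := by
    have hterm : ∀ i j, D (e i j) (L (e j i) (R (e k l) y)) =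
        D (e k l * e i j) (L (e j i) y) - D (e k l) (L (e i i) y) := by
      intro i j
      rw [hLR, hD, ← hL (e i j), he i j, if_pos rfl, add_sub_cancel_right]
    simp only [hterm, Finset.sum_sub_distrib]
    congr 1
    · rw [Finset.sum_comm]
      refine Finset.sum_congr rfl fun j _ => ?_
      rw [Finset.sum_eq_single_of_mem l (Finset.mem_range.2 hl), he, if_pos rfl]
      intro i _ hil
      rw [he, if_neg (Ne.symm hil), map_zero, zero_apply]
    · simp [map_sum, Finset.mul_sum]
  rw [h1, h2, sub_sub_cancel]

/-- A derivation which is bounded on signed permutation matrices splits into two module maps. -/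
lemma exists_derivation_eq
    (he : ∀ i j k l, e i j * e k l = if j = k then e i l else 0)
    (hcompress : ∀ b k l, ∃ c : ℝ, e k k * b * e l l = c • e k l)
    (hL : ∀ a b y, L (a * b) y = L a (L b y))
    (hR : ∀ a b y, R (a * b) y = R b (R a y))
    (hLR : ∀ a b y, L a (R b y) = R b (L a y))
    (hD : ∀ a b y, D (a * b) y = D b (R a y) + D a (L b y))
    (hLlim : ∀ (φ : W →L[ℝ] ℝ) (y : W),
      Tendsto (fun n => φ (L (∑ i ∈ Finset.range n, e i i) y)) atTop (𝓝 (φ (L 1 y))))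
    (hRlim : ∀ (φ : W →L[ℝ] ℝ) (y : W),
      Tendsto (fun n => φ (R (∑ i ∈ Finset.range n, e i i) y)) atTop (𝓝 (φ (R 1 y))))
    {K : ℝ} (hK : ∀ (n : ℕ) (τ : Equiv.Perm (Fin n)) (ε : Fin n → ℝ), (∀ i, |ε i| = 1) → ∀ y,
      |D (∑ i, ε i • e i (τ i)) (L (∑ i, ε i • e (τ i) i) y)| ≤ K * ‖y‖) :
    ∃ η θ : W →L[ℝ] ℝ, ∀ b y, D b y = η (L b y) + θ (R b y) := by
  obtain ⟨ξ, hξ⟩ := exists_hyperfilter_limit (diagonalFunctional e L D)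
    (abs_diagonalFunctional_le hK)
  let p : ℕ → A := fun n => ∑ i ∈ Finset.range n, e i i
  let Q : Submodule ℝ A :=
    { carrier := {a | ∀ y, D a (L 1 y) = ξ (L a y) - ξ (R a y)}
      add_mem' := fun {a b} ha hb y => by
        simp only [map_add, add_apply, ha y, hb y]
        ring
      zero_mem' := fun y => by simp
      smul_mem' := fun c a ha y => by
        simp only [map_smul, smul_apply, ha y, smul_eq_mul]
        ring }
  have hunit : ∀ k l, e k l ∈ Q := by
    intro k l y
    refine tendsto_nhds_unique
      ((hLlim (D (e k l)) y).mono_left Nat.hyperfilter_le_atTop) ?_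
    refine ((hξ (L (e k l) y)).sub (hξ (R (e k l) y))).congr' ?_
    filter_upwards [Nat.hyperfilter_le_atTop (eventually_gt_atTop (max k l))] with n hn
    exact (derivation_matrixUnit he hL hLR hD ((le_max_left _ _).trans_lt hn)
      ((le_max_right _ _).trans_lt hn) y).symm
  have hp : ∀ n, p n ∈ Q := fun n => Q.sum_mem fun i _ => hunit i i
  have hcomp : ∀ n b m, p n * b * p m ∈ Q := by
    intro n b m
    simp only [p, Finset.sum_mul, Finset.mul_sum]
    refine Q.sum_mem fun k _ => Q.sum_mem fun l _ => ?_
    obtain ⟨c, hc⟩ := hcompress b l k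
    rw [hc]
    exact Q.smul_mem c (hunit _ _)
  have hzero : ∀ b n m y, D b (L (p m) (R (p n) y)) =
      ξ (L b (L (p m) (R (p n) y))) - ξ (R b (L (p m) (R (p n) y))) := by
    intro b n m y
    have h1 := hcomp n b m y
    have h2 := hp m (R b (R (p n) y))
    have h3 := hp n (L b (L (p m) y))
    have h4 : D (p n * b * p m) (L 1 y) = D (p m) (L 1 (R b (R (p n) y))) +
        D b (L (p m) (R (p n) y)) + D (p n) (L 1 (L b (L (p m) y))) := by
      have e1 : L (p m) (R (p n) (L 1 y)) = R (p n) (L (p m) y) := by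
        rw [hLR, ← hL, mul_one]
      have e2 : L (b * p m) (L 1 y) = L 1 (L b (L (p m) y)) := by
        rw [← hL, ← hL, ← hL, mul_one, one_mul]
      rw [mul_assoc, hD, hD b, hLR 1, hLR 1, e1, e2, hLR (p m) (p n) y]
    rw [h4, h2, h3, mul_assoc, hL (p n), hL b, hR (p n), hR b] at h1
    simp only [hLR] at h1 ⊢
    linarith
  have hzero₁ : ∀ b n y, D b (L 1 (R (p n) y)) =
      ξ (L b (L 1 (R (p n) y))) - ξ (R b (L 1 (R (p n) y))) := by
    intro b n y
    have := hLlim (D b - ξ ∘L L b + ξ ∘L R b) (R (p n) y)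
    refine sub_eq_zero.1 ?_
    have h0 := tendsto_nhds_unique (this.congr fun m => ?_) (tendsto_const_nhds (x := (0 : ℝ)))
    · simp only [add_apply, sub_apply, ContinuousLinearMap.comp_apply] at h0
      linarith
    · simp only [add_apply, sub_apply, ContinuousLinearMap.comp_apply]
      linarith [hzero b n m y]
  have hone : ∀ b y, D b (R 1 (L 1 y)) =
      ξ (L b (R 1 (L 1 y))) - ξ (R b (R 1 (L 1 y))) := by
    intro b y
    have := hRlim (D b - ξ ∘L L b + ξ ∘L R b) (L 1 y)
    refine sub_eq_zero.1 ?_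
    have h0 := tendsto_nhds_unique (this.congr fun n => ?_) (tendsto_const_nhds (x := (0 : ℝ)))
    · simp only [add_apply, sub_apply, ContinuousLinearMap.comp_apply] at h0
      linarith
    · simp only [add_apply, sub_apply, ContinuousLinearMap.comp_apply]
      have := hzero₁ b n y
      rw [hLR 1 (p n)] at this
      linarith
  refine ⟨D 1 + ξ ∘L R 1, D 1 - ξ ∘L L 1, fun b y => ?_⟩
  have h1 := hD 1 b y
  have h2 := hD b 1 (R 1 y)
  rw [one_mul] at h1
  rw [mul_one, hLR 1, hone, ← hR 1 b, one_mul] at h2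
  have e1 : L b (R 1 (L 1 y)) = R 1 (L b y) := by rw [hLR, ← hL, mul_one]
  have e2 : R b (R 1 (L 1 y)) = L 1 (R b y) := by rw [← hR, one_mul, hLR]
  rw [e1, e2] at h2
  simp only [add_apply, sub_apply, ContinuousLinearMap.comp_apply]
  linarith

end MatrixUnits

section RegularOperators

variable {X : Type*} [NormedAddCommGroup X] [Lattice X] [NormedSpace ℝ X]

lemma rnorm_nonneg (T : X →L[ℝ] X) : 0 ≤ rnorm T := by
  refine Real.sInf_nonneg ?_
  rintro _ ⟨S, rfl, -⟩
  exact norm_nonneg S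

lemma rnorm_le {T S : X →L[ℝ] X} {K : ℝ} (hTS : ∀ x, |T x| ≤ S |x|) (hS : ‖S‖ ≤ K) :
    rnorm T ≤ K := by
  refine le_trans (csInf_le ⟨0, ?_⟩ (by exact ⟨S, rfl, hTS⟩)) hS
  rintro _ ⟨S, rfl, -⟩
  exact norm_nonneg S

variable [HasSolidNorm X] [IsOrderedAddMonoid X]

lemma mem_LrSet_iff {T : X →L[ℝ] X} :
    T ∈ LrSet X ↔ T ∈ Submodule.span ℝ {S : X →L[ℝ] X | IsPosOp S} := by
  rw [Submodule.mem_span_set']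
  constructor
  · rintro ⟨n, c, S, hS, rfl⟩
    exact ⟨n, c, fun i => ⟨S i, hS i⟩, rfl⟩
  · rintro ⟨n, c, S, rfl⟩
    exact ⟨n, c, fun i => S i, fun i => (S i).2, rfl⟩

lemma IsPosOp.mem_LrSet {T : X →L[ℝ] X} (hT : IsPosOp T) : T ∈ LrSet X :=
  mem_LrSet_iff.2 (Submodule.subset_span hT)

lemma comp_mem_LrSet {S T : X →L[ℝ] X} (hS : S ∈ LrSet X) (hT : T ∈ LrSet X) :
    S * T ∈ LrSet X := by
  rw [mem_LrSet_iff] at *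
  have := Submodule.mul_mem_mul hS hT
  rw [Submodule.span_mul_span] at this
  refine Submodule.span_mono ?_ this
  rintro _ ⟨a, ha, b, hb, rfl⟩
  exact fun x hx => ha _ (hb x hx)

variable (X) in
/-- The algebra of regular operators. -/
def regularSubalgebra : Subalgebra ℝ (X →L[ℝ] X) where
  carrier := LrSet X
  mul_mem' := comp_mem_LrSet
  add_mem' ha hb := by
    rw [mem_LrSet_iff] at *
    exact add_mem ha hb
  algebraMap_mem' r := by
    rw [Algebra.algebraMap_eq_smul_one, mem_LrSet_iff]
    exact Submodule.smul_mem _ r (Submodule.subset_span fun _ h => h)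

namespace IsAtomicBasis

variable {x : ℕ → X} {xs : ℕ → X →L[ℝ] ℝ}

lemma isPosOp_smulRight (h : IsAtomicBasis x xs) (i j : ℕ) : IsPosOp ((xs j).smulRight (x i)) :=
  fun _ hy => smul_nonneg (h.coord_nonneg j hy) (h.pos i)

/-- The matrix units of the basis as regular operators. -/
def matrixUnit (h : IsAtomicBasis x xs) (i j : ℕ) : regularSubalgebra X :=
  ⟨(xs j).smulRight (x i), (h.isPosOp_smulRight i j).mem_LrSet⟩

lemma coe_matrixUnit (h : IsAtomicBasis x xs) (i j : ℕ) :
    (h.matrixUnit i j : X →L[ℝ] X) = (xs j).smulRight (x i) := rfl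

lemma matrixUnit_mul (h : IsAtomicBasis x xs) (i j k l : ℕ) :
    h.matrixUnit i j * h.matrixUnit k l = if j = k then h.matrixUnit i l else 0 := by
  ext y
  split_ifs with hjk <;> simp [coe_matrixUnit, h.biorth, hjk]

lemma matrixUnit_mul_mul (h : IsAtomicBasis x xs) (b : regularSubalgebra X) (k l : ℕ) :
    h.matrixUnit k k * b * h.matrixUnit l l =
      xs k ((b : X →L[ℝ] X) (x l)) • h.matrixUnit k l := by
  ext y
  simp [coe_matrixUnit, smul_smul, mul_comm]

lemma coe_sum_matrixUnit (h : IsAtomicBasis x xs) (n : ℕ) :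
    ((∑ i ∈ Finset.range n, h.matrixUnit i i : regularSubalgebra X) : X →L[ℝ] X) =
      ∑ i ∈ Finset.range n, (xs i).smulRight (x i) := by
  simp [coe_matrixUnit]

lemma rnorm_signed_permutation_le (h : IsAtomicBasis x xs) {K : ℝ} (hK0 : 0 ≤ K)
    (hK : ∀ n (τ : Equiv.Perm (Fin n)) (α : ℕ → ℝ),
      ‖∑ i : Fin n, α i • x (τ i)‖ ≤ K * ‖∑ i ∈ Finset.range n, α i • x i‖)
    {n : ℕ} (τ : Equiv.Perm (Fin n)) {ε : Fin n → ℝ} (hε : ∀ i, |ε i| = 1) :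
    rnorm ((∑ i, ε i • h.matrixUnit (τ i) i : regularSubalgebra X) : X →L[ℝ] X) ≤ K := by
  refine rnorm_le (S := ∑ i : Fin n, (xs i).smulRight (x (τ i))) (fun z => ?_)
    (ContinuousLinearMap.opNorm_le_bound _ hK0 fun z => ?_)
  · have h1 := h.abs_sum_le Finset.univ (fun i : Fin n => (τ i : ℕ)) fun i => ε i * xs i z
    simp only [abs_mul, hε, one_mul] at h1
    simp only [AddSubmonoidClass.coe_finsetSum, Subalgebra.coe_smul, coe_matrixUnit, sum_apply,
      smul_apply, ContinuousLinearMap.smulRight_apply, smul_smul]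
    exact h1.trans (Finset.sum_le_sum fun i _ =>
      smul_le_smul_of_nonneg_right (h.abs_coord_le i z) (h.pos _))
  · simp only [sum_apply, ContinuousLinearMap.smulRight_apply]
    exact (hK n τ fun i => xs i z).trans
      (mul_le_mul_of_nonneg_left (h.norm_sum_coord_le _ z) hK0)

lemma rnorm_signed_permutation_symm_le (h : IsAtomicBasis x xs) {K : ℝ} (hK0 : 0 ≤ K)
    (hK : ∀ n (τ : Equiv.Perm (Fin n)) (α : ℕ → ℝ),
      ‖∑ i : Fin n, α i • x (τ i)‖ ≤ K * ‖∑ i ∈ Finset.range n, α i • x i‖)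
    {n : ℕ} (τ : Equiv.Perm (Fin n)) {ε : Fin n → ℝ} (hε : ∀ i, |ε i| = 1) :
    rnorm ((∑ i, ε i • h.matrixUnit i (τ i) : regularSubalgebra X) : X →L[ℝ] X) ≤ K := by
  rw [← Equiv.sum_comp τ.symm]
  simp only [Equiv.apply_symm_apply]
  exact h.rnorm_signed_permutation_le hK0 hK τ.symm (ε := fun i => ε (τ.symm i)) fun i => hε _

end IsAtomicBasis

/-- Bundle an action by bounded additive maps, linear in the operator. -/
lemma exists_linearMap_of_action {W : Type*} [NormedAddCommGroup W] [NormedSpace ℝ W]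
    (m : (X →L[ℝ] X) → W → W) (M : ℝ)
    (hadd : ∀ a ∈ LrSet X, ∀ y₁ y₂, m a (y₁ + y₂) = m a y₁ + m a y₂)
    (hlin : ∀ a ∈ LrSet X, ∀ b ∈ LrSet X, ∀ (s t : ℝ) (y : W),
      m (s • a + t • b) y = s • m a y + t • m b y)
    (hbd : ∀ a ∈ LrSet X, ∀ y, ‖m a y‖ ≤ M * rnorm a * ‖y‖) :
    ∃ L : regularSubalgebra X →ₗ[ℝ] W →L[ℝ] W, ∀ a y, L a y = m a y := by
  have hcont : ∀ a : regularSubalgebra X, Continuous (AddMonoidHom.mk' (m a) (hadd a a.2)) :=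
    fun a => AddMonoidHomClass.continuous_of_bound _ _ (hbd a a.2)
  refine ⟨⟨⟨fun a => AddMonoidHom.toRealLinearMap _ (hcont a), fun a b => ?_⟩, fun c a => ?_⟩,
    fun a y => rfl⟩
  · ext y
    simpa using hlin a a.2 b b.2 1 1 y
  · ext y
    simpa using hlin a a.2 a a.2 c 0 y

end RegularOperators

theorem Lr_derivation_regular_symmetric
    {X 𝔛 : Type*} [NormedAddCommGroup X] [Lattice X] [HasSolidNorm X] [IsOrderedAddMonoid X] [NormedSpace ℝ X] [CompleteSpace X]
    [NormedAddCommGroup 𝔛] [Lattice 𝔛] [HasSolidNorm 𝔛] [IsOrderedAddMonoid 𝔛] [NormedSpace ℝ 𝔛] [CompleteSpace 𝔛]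
    -- X = (⊕ᵢ Xᵢ)_𝐞 is order complete:
    (hXoc : ∀ S : Set X, S.Nonempty → BddAbove S → ∃ b, IsLUB S b)
    (μ : ℝ) (hμ : 1 ≤ μ)
    -- (x i) is a shrinking basis for X satisfying (⋆) with constant μ in each summand:
    (x : ℕ → X) (xs : ℕ → X →L[ℝ] ℝ)
    (hstar : StarSummandBasis μ x)
    (hbi : ∀ i j, xs i (x j) = if i = j then (1 : ℝ) else 0)
    (hbasis : ∀ y : X, Tendsto (fun n => ∑ i ∈ Finset.range n, xs i y • x i) atTop (𝓝 y))
    (hshrink : ∀ l : X →L[ℝ] ℝ,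
      Tendsto (fun n => ‖l - ∑ i ∈ Finset.range n, l (x i) • xs i‖) atTop (𝓝 0))
    -- 𝔛 is a Banach lattice ℒʳ(X)-module, with actions Ml, Mr and constant M:
    (Ml Mr : (X →L[ℝ] X) → 𝔛 → 𝔛) (M : ℝ)
    (hMladd : ∀ a ∈ LrSet X, ∀ y₁ y₂ : 𝔛, Ml a (y₁ + y₂) = Ml a y₁ + Ml a y₂)
    (hMradd : ∀ a ∈ LrSet X, ∀ y₁ y₂ : 𝔛, Mr a (y₁ + y₂) = Mr a y₁ + Mr a y₂)
    (hMllin : ∀ a ∈ LrSet X, ∀ b ∈ LrSet X, ∀ (s t : ℝ) (y : 𝔛),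
      Ml (s • a + t • b) y = s • Ml a y + t • Ml b y)
    (hMrlin : ∀ a ∈ LrSet X, ∀ b ∈ LrSet X, ∀ (s t : ℝ) (y : 𝔛),
      Mr (s • a + t • b) y = s • Mr a y + t • Mr b y)
    (hMlmul : ∀ a ∈ LrSet X, ∀ b ∈ LrSet X, ∀ y : 𝔛, Ml (a ∘L b) y = Ml a (Ml b y))
    (hMrmul : ∀ a ∈ LrSet X, ∀ b ∈ LrSet X, ∀ y : 𝔛, Mr (a ∘L b) y = Mr b (Mr a y))
    (hMlr : ∀ a ∈ LrSet X, ∀ b ∈ LrSet X, ∀ y : 𝔛, Ml a (Mr b y) = Mr b (Ml a y))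
    (hMpos : ∀ a ∈ LrSet X, IsPosOp a → ∀ y : 𝔛, 0 ≤ y → 0 ≤ Ml a y ∧ 0 ≤ Mr a y)
    (hMbd : ∀ a ∈ LrSet X, ∀ y : 𝔛,
      ‖Ml a y‖ ≤ M * rnorm a * ‖y‖ ∧ ‖Mr a y‖ ≤ M * rnorm a * ‖y‖)
    -- dual module products on 𝔛′ := 𝔛 →L[ℝ] ℝ :
    (DL DR : (X →L[ℝ] X) → (𝔛 →L[ℝ] ℝ) → (𝔛 →L[ℝ] ℝ))
    (hDL : ∀ a ∈ LrSet X, ∀ (x' : 𝔛 →L[ℝ] ℝ) (y : 𝔛), DL a x' y = x' (Mr a y))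
    (hDR : ∀ a ∈ LrSet X, ∀ (x' : 𝔛 →L[ℝ] ℝ) (y : 𝔛), DR a x' y = x' (Ml a y))
    -- sup_n e_n·x′ = e·x′ and sup_n x′·e_n = x′·e for x′ ∈ 𝔛′₊ (e = id_X):
    (hsup : ∀ x' : 𝔛 →L[ℝ] ℝ, dualLe 0 x' →
      dualIsLUB (Set.range fun n =>
        DL (∑ i ∈ Finset.range n, (xs i).smulRight (x i)) x')
        (DL (ContinuousLinearMap.id ℝ X) x') ∧
      dualIsLUB (Set.range fun n =>
        DR (∑ i ∈ Finset.range n, (xs i).smulRight (x i)) x')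
        (DR (ContinuousLinearMap.id ℝ X) x'))
    -- (x i) is symmetric:
    (hsym : ∀ π : Equiv.Perm ℕ, ∃ L : ℝ, 0 < L ∧ ∀ (m : ℕ) (α : ℕ → ℝ),
      ‖∑ i ∈ Finset.range m, α i • x i‖ ≤ L * ‖∑ i ∈ Finset.range m, α i • x (π i)‖ ∧
      ‖∑ i ∈ Finset.range m, α i • x (π i)‖ ≤ L * ‖∑ i ∈ Finset.range m, α i • x i‖)
    -- D is a bounded derivation from ℒʳ(X) to 𝔛′:
    (D : (X →L[ℝ] X) → (𝔛 →L[ℝ] ℝ))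
    (hDadd : ∀ a ∈ LrSet X, ∀ b ∈ LrSet X, D (a + b) = D a + D b)
    (hDsmul : ∀ (r : ℝ), ∀ a ∈ LrSet X, D (r • a) = r • D a)
    (hDder : ∀ a ∈ LrSet X, ∀ b ∈ LrSet X, D (a ∘L b) = DL a (D b) + DR b (D a))
    (hDbdd : ∃ C : ℝ, ∀ a ∈ LrSet X, ‖D a‖ ≤ C * rnorm a) :
    RegularDerivOn (LrSet X) D := by
  obtain ⟨I, ψ, -, -, -, hatom, -⟩ := hstar
  have h : IsAtomicBasis x xs := ⟨hatom, hbi, hbasis⟩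
  obtain ⟨K, hK0, hK⟩ := h.exists_symmetric_bound hsym
  obtain ⟨C, hC⟩ := hDbdd
  obtain ⟨L, hL⟩ := exists_linearMap_of_action Ml M hMladd hMllin fun a ha y => (hMbd a ha y).1
  obtain ⟨R, hR⟩ := exists_linearMap_of_action Mr M hMradd hMrlin fun a ha y => (hMbd a ha y).2
  let D' : regularSubalgebra X →ₗ[ℝ] 𝔛 →L[ℝ] ℝ :=
    ⟨⟨fun a => D a, fun a b => hDadd a a.2 b b.2⟩, fun c a => hDsmul c a a.2⟩
  have hsum : ∀ n, ∑ i ∈ Finset.range n, (xs i).smulRight (x i) ∈ LrSet X := fun n => by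
    rw [← h.coe_sum_matrixUnit]
    exact (∑ i ∈ Finset.range n, h.matrixUnit i i).2
  have hsucc : ∀ n, ∀ y : 𝔛, 0 ≤ y →
      Ml (∑ i ∈ Finset.range n, (xs i).smulRight (x i)) y ≤
        Ml (∑ i ∈ Finset.range (n + 1), (xs i).smulRight (x i)) y ∧
      Mr (∑ i ∈ Finset.range n, (xs i).smulRight (x i)) y ≤
        Mr (∑ i ∈ Finset.range (n + 1), (xs i).smulRight (x i)) y := by
    intro n y hy
    have hn := h.isPosOp_smulRight n n
    have h1 := hMllin _ (hsum n) _ hn.mem_LrSet 1 1 y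
    have h2 := hMrlin _ (hsum n) _ hn.mem_LrSet 1 1 y
    simp only [one_smul] at h1 h2
    rw [Finset.sum_range_succ, h1, h2]
    exact ⟨le_add_of_nonneg_right (hMpos _ hn.mem_LrSet hn y hy).1,
      le_add_of_nonneg_right (hMpos _ hn.mem_LrSet hn y hy).2⟩
  have hid : ContinuousLinearMap.id ℝ X ∈ LrSet X := (regularSubalgebra X).one_mem
  have hdual : ∀ f : 𝔛 →L[ℝ] ℝ, dualLe 0 f → ∀ y z : 𝔛, y ≤ z → f y ≤ f z := by
    intro f hf y z hyz
    simpa using hf _ (sub_nonneg.2 hyz)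
  obtain ⟨η, θ, hηθ⟩ := exists_derivation_eq (e := h.matrixUnit) (L := L) (R := R) (D := D')
    (K := |C| * K * (|M| * K)) h.matrixUnit_mul
    (fun b k l => ⟨_, h.matrixUnit_mul_mul b k l⟩)
    (fun a b y => by simp only [hL]; exact hMlmul a a.2 b b.2 y)
    (fun a b y => by simp only [hR]; exact hMrmul a a.2 b b.2 y)
    (fun a b y => by simp only [hL, hR]; exact hMlr a a.2 b b.2 y)
    (fun a b y => by
      have := DFunLike.congr_fun (hDder a a.2 b b.2) y
      rw [add_apply, hDL a a.2, hDR b b.2] at this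
      rw [hL, hR]
      exact this)
    (fun φ y => by
      obtain ⟨f, g, hf, hg, rfl⟩ := exists_dual_pos_sub φ
      have key : ∀ f : 𝔛 →L[ℝ] ℝ, dualLe 0 f → Tendsto
          (fun n => f (L (∑ i ∈ Finset.range n, h.matrixUnit i i) y)) atTop (𝓝 (f (L 1 y))) := by
        intro f hf
        have := tendsto_of_dualIsLUB (fun n z hz => by
          rw [hDR _ (hsum _), hDR _ (hsum _)]
          exact hdual f hf _ _ (hsucc n z hz).1) (hsup f hf).2 y
        simp only [hDR _ (hsum _), hDR _ hid] at this
        simp only [hL, h.coe_sum_matrixUnit]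
        exact this
      exact (key f hf).sub (key g hg))
    (fun φ y => by
      obtain ⟨f, g, hf, hg, rfl⟩ := exists_dual_pos_sub φ
      have key : ∀ f : 𝔛 →L[ℝ] ℝ, dualLe 0 f → Tendsto
          (fun n => f (R (∑ i ∈ Finset.range n, h.matrixUnit i i) y)) atTop (𝓝 (f (R 1 y))) := by
        intro f hf
        have := tendsto_of_dualIsLUB (fun n z hz => by
          rw [hDL _ (hsum _), hDL _ (hsum _)]
          exact hdual f hf _ _ (hsucc n z hz).2) (hsup f hf).1 y
        simp only [hDL _ (hsum _), hDL _ hid] at this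
        simp only [hR, h.coe_sum_matrixUnit]
        exact this
      exact (key f hf).sub (key g hg))
    (fun n τ ε hε y => by
      set u := ∑ i, ε i • h.matrixUnit i (τ i) with hu
      set v := ∑ i, ε i • h.matrixUnit (τ i) i with hv
      have hru : rnorm (u : X →L[ℝ] X) ≤ K := h.rnorm_signed_permutation_symm_le hK0 hK τ hε
      have hrv : rnorm (v : X →L[ℝ] X) ≤ K := h.rnorm_signed_permutation_le hK0 hK τ hε
      have hDu : ‖D' u‖ ≤ |C| * K := (hC u u.2).trans <|
        mul_le_mul (le_abs_self C) hru (rnorm_nonneg _) (abs_nonneg C)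
      have hLv : ‖L v y‖ ≤ |M| * K * ‖y‖ := by
        rw [hL]
        exact (hMbd v v.2 y).1.trans <| mul_le_mul_of_nonneg_right
          (mul_le_mul (le_abs_self M) hrv (rnorm_nonneg _) (abs_nonneg M)) (norm_nonneg y)
      rw [mul_assoc (|C| * K)]
      exact ((D' u).le_opNorm _).trans
        (mul_le_mul hDu hLv (norm_nonneg _) (by positivity)))
  obtain ⟨η₁, η₂, hη₁, hη₂, rfl⟩ := exists_dual_pos_sub η
  obtain ⟨θ₁, θ₂, hθ₁, hθ₂, rfl⟩ := exists_dual_pos_sub θ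
  have hDRreg : ∀ f : 𝔛 →L[ℝ] ℝ, dualLe 0 f →
      (∀ a ∈ LrSet X, ∀ b ∈ LrSet X, DR (a + b) f = DR a f + DR b f) ∧
      (∀ (r : ℝ), ∀ a ∈ LrSet X, DR (r • a) f = r • DR a f) ∧
      (∀ a ∈ LrSet X, IsPosOp a → dualLe 0 (DR a f)) := by
    refine fun f hf => ⟨fun a ha b hb => ?_, fun r a ha => ?_, fun a ha hpos y hy => ?_⟩
    · ext y
      have := hMllin a ha b hb 1 1 y
      simp only [one_smul] at this
      rw [add_apply, hDR _ ((regularSubalgebra X).add_mem ha hb), hDR a ha, hDR b hb, this,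
        map_add]
    · ext y
      have := hMllin a ha a ha r 0 y
      simp only [zero_smul, add_zero] at this
      rw [smul_apply, hDR _ ((regularSubalgebra X).smul_mem ha r), hDR a ha, this, map_smul]
    · rw [hDR a ha]
      exact hf _ (hMpos a ha hpos y hy).1
  have hDLreg : ∀ f : 𝔛 →L[ℝ] ℝ, dualLe 0 f →
      (∀ a ∈ LrSet X, ∀ b ∈ LrSet X, DL (a + b) f = DL a f + DL b f) ∧
      (∀ (r : ℝ), ∀ a ∈ LrSet X, DL (r • a) f = r • DL a f) ∧
      (∀ a ∈ LrSet X, IsPosOp a → dualLe 0 (DL a f)) := by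
    refine fun f hf => ⟨fun a ha b hb => ?_, fun r a ha => ?_, fun a ha hpos y hy => ?_⟩
    · ext y
      have := hMrlin a ha b hb 1 1 y
      simp only [one_smul] at this
      rw [add_apply, hDL _ ((regularSubalgebra X).add_mem ha hb), hDL a ha, hDL b hb, this,
        map_add]
    · ext y
      have := hMrlin a ha a ha r 0 y
      simp only [zero_smul, add_zero] at this
      rw [smul_apply, hDL _ ((regularSubalgebra X).smul_mem ha r), hDL a ha, this, map_smul]
    · rw [hDL a ha]
      exact hf _ (hMpos a ha hpos y hy).2
  refine ⟨4, ![1, -1, 1, -1], ![fun a => DR a η₁, fun a => DR a η₂, fun a => DL a θ₁,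
    fun a => DL a θ₂], fun t => ?_, fun a ha => ?_⟩
  · fin_cases t
    exacts [hDRreg η₁ hη₁, hDRreg η₂ hη₂, hDLreg θ₁ hθ₁, hDLreg θ₂ hθ₂]
  · ext y
    have := hηθ ⟨a, ha⟩ y
    rw [hL, hR] at this
    refine this.trans ?_
    simp only [Fin.sum_univ_four, Matrix.cons_val, add_apply, sub_apply, smul_apply,
      hDR a ha, hDL a ha, smul_eq_mul]
    ring
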